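/- Let f be an odd positive integer. Every unit of R₁/fR₁ that is fixed by the automorphism induced by complex conjugation lies in the image of (R⁺₁/fR⁺₁)ˣ under the natural (injective) ring map R⁺₁/fR⁺₁ → R₁/fR₁. -/

import Mathlib

noncomputable section
open Complex Pointwise

/-- `√−2 = i·√2` -/
def sm2 : ℂ := Complex.I * Real.sqrt 2
/-- `√−D = i·√D` -/
def smD (D : ℕ) : ℂ := Complex.I * Real.sqrt D
/-- `√(2D)` -/
def s2D (D : ℕ) : ℂ := (Real.sqrt (2 * D) : ℝ)
/-- `w = (√(2D) + √−2)/2` -/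
def w (D : ℕ) : ℂ := (s2D D + sm2) / 2
/-- `𝒪 = ℤ[√−2]` -/
def OO : Subring ℂ := Subring.closure {sm2}
/-- `R_f = 𝒪 + f·w·𝒪 = ℤ[√−2, f·w]`, an order in `K`. -/
def Rf (D f : ℕ) : Subring ℂ := Subring.closure {sm2, (f : ℂ) * w D}
/-- `R⁺_f = ℤ[f·√(2D)]`, an order in `K⁺`. -/
def Rpf (D f : ℕ) : Subring ℂ := Subring.closure {(f : ℂ) * s2D D}
/-- `S_f = ℤ[f·√−D]`, an order in `L`. -/
def Sf (D f : ℕ) : Subring ℂ := Subring.closure {(f : ℂ) * smD D}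
/-- `K = ℚ(√−2, √−D)` -/
def Kf (D : ℕ) : IntermediateField ℚ ℂ := IntermediateField.adjoin ℚ {sm2, smD D}
/-- `K⁺ = ℚ(√(2D))`, the maximal real subfield of `K`. -/
def Kp (D : ℕ) : IntermediateField ℚ ℂ := IntermediateField.adjoin ℚ {s2D D}
/-- `L = ℚ(√−D)` -/
def Lf (D : ℕ) : IntermediateField ℚ ℂ := IntermediateField.adjoin ℚ {smD D}

lemma conj_sm2 : (starRingEnd ℂ) sm2 = -sm2 := by
  simp [sm2]

lemma conj_s2D (D : ℕ) : (starRingEnd ℂ) (s2D D) = s2D D := by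
  simp [s2D]

lemma conj_w (D : ℕ) : (starRingEnd ℂ) (w D) = w D - sm2 := by
  have h2 : (starRingEnd ℂ) (2 : ℂ) = 2 := by
    simp [Complex.ext_iff]
  rw [w, map_div₀, map_add, conj_s2D, conj_sm2, h2]
  ring

/-- `R_f` is stable under complex conjugation. -/
lemma conj_mem_Rf (D f : ℕ) : ∀ x ∈ Rf D f, (starRingEnd ℂ) x ∈ Rf D f := by
  intro x hx
  induction hx using Subring.closure_induction with
  | mem y hy =>
      rcases hy with rfl | rfl
      · rw [conj_sm2]
        exact neg_mem (Subring.subset_closure (Or.inl rfl))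
      · rw [map_mul, conj_w]
        have h1 : (f : ℂ) * w D ∈ Rf D f := Subring.subset_closure (Or.inr rfl)
        have h2 : sm2 ∈ Rf D f := Subring.subset_closure (Or.inl rfl)
        have h3 : (starRingEnd ℂ) (f : ℂ) = (f : ℂ) := by simp
        rw [h3, mul_sub]
        exact sub_mem h1 (mul_mem (natCast_mem _ f) h2)
  | one => simpa using one_mem (Rf D f)
  | zero => simpa using zero_mem (Rf D f)
  | add x y hx hy ihx ihy => rw [map_add]; exact add_mem ihx ihy
  | neg x hx ihx => rw [map_neg]; exact neg_mem ihx
  | mul x y hx hy ihx ihy => rw [map_mul]; exact mul_mem ihx ihy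

/-- Complex conjugation as a ring endomorphism of a conjugation-stable subring of `ℂ`. -/
def subringConj (R : Subring ℂ) (h : ∀ x ∈ R, (starRingEnd ℂ) x ∈ R) : R →+* R where
  toFun x := ⟨(starRingEnd ℂ) x, h x x.2⟩
  map_one' := Subtype.ext (by simp)
  map_mul' x y := Subtype.ext (by simp)
  map_zero' := Subtype.ext (by simp)
  map_add' x y := Subtype.ext (by simp)

lemma s2D_eq (D : ℕ) : (s2D D : ℂ) = 2 * w D - sm2 := by
  unfold w; ring

/-- `R⁺_f ⊆ R_f`. -/
lemma Rpf_le_Rf (D f : ℕ) : Rpf D f ≤ Rf D f := by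
  rw [Rpf, Subring.closure_le]
  intro y hy
  rcases hy with rfl
  have h1 : (f : ℂ) * w D ∈ Rf D f := Subring.subset_closure (Or.inr rfl)
  have h2 : sm2 ∈ Rf D f := Subring.subset_closure (Or.inl rfl)
  have heq : (f : ℂ) * s2D D = ((f : ℂ) * w D + (f : ℂ) * w D) - (f : ℂ) * sm2 := by
    rw [s2D_eq]; ring
  rw [SetLike.mem_coe, heq]
  exact sub_mem (add_mem h1 h1) (mul_mem (natCast_mem _ f) h2)

lemma w_mem_R1 (D : ℕ) : w D ∈ Rf D 1 := by
  have := Subring.subset_closure (s := {sm2, ((1:ℕ) : ℂ) * w D}) (Or.inr rfl)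
  simpa [Rf] using this

/-- `R_f ⊆ R₁`. -/
lemma Rf_le_R1 (D f : ℕ) : Rf D f ≤ Rf D 1 := by
  rw [Rf, Subring.closure_le]
  intro y hy
  rcases hy with rfl | rfl
  · exact Subring.subset_closure (Or.inl rfl)
  · exact mul_mem (natCast_mem _ f) (w_mem_R1 D)

/-- `R⁺_f ⊆ R⁺₁`. -/
lemma Rpf_le_Rp1 (D f : ℕ) : Rpf D f ≤ Rpf D 1 := by
  rw [Rpf, Subring.closure_le]
  intro y hy
  rcases hy with rfl
  have h0 : ((1:ℕ) : ℂ) * s2D D ∈ Rpf D 1 := Subring.subset_closure rfl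
  have h1 : s2D D ∈ Rpf D 1 := by simpa using h0
  rw [SetLike.mem_coe]
  exact mul_mem (natCast_mem _ f) h1

/-- The ideal `f·R` of a subring `R` of `ℂ`. -/
def fIdeal (R : Subring ℂ) (f : ℕ) : Ideal R := Ideal.span {(f : R)}

/-- The ring homomorphism `R/fR → S/fS` induced by an inclusion `R ≤ S` of subrings of `ℂ`. -/
def quotIncl {R S : Subring ℂ} (h : R ≤ S) (f : ℕ) :
    R ⧸ fIdeal R f →+* S ⧸ fIdeal S f :=
  Ideal.quotientMap _ (Subring.inclusion h) (by
    rw [fIdeal, Ideal.span_le]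
    intro x hx
    rcases Set.mem_singleton_iff.1 hx with rfl
    show Subring.inclusion h ((f : ℕ) : R) ∈ fIdeal S f
    rw [map_natCast]
    exact Ideal.subset_span rfl)

/-- Conjugation on `R/fR` induced by complex conjugation on a stable subring `R`. -/
def quotConj (R : Subring ℂ) (hc : ∀ x ∈ R, (starRingEnd ℂ) x ∈ R) (f : ℕ) :
    R ⧸ fIdeal R f →+* R ⧸ fIdeal R f :=
  Ideal.quotientMap _ (subringConj R hc) (by
    rw [fIdeal, Ideal.span_le]
    intro x hx
    rcases Set.mem_singleton_iff.1 hx with rfl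
    show subringConj R hc ((f : ℕ) : R) ∈ fIdeal R f
    rw [map_natCast]
    exact Ideal.subset_span rfl)

lemma sm2_sq : sm2 ^ 2 = -2 := by
  rw [sm2, mul_pow, I_sq, ← ofReal_pow, Real.sq_sqrt (by norm_num)]
  norm_num

lemma s2D_sq (D : ℕ) : s2D D ^ 2 = 2 * D := by
  rw [s2D, ← ofReal_pow, Real.sq_sqrt (by positivity)]
  push_cast
  rfl

lemma s2D_mem_Rp1 (D : ℕ) : s2D D ∈ Rpf D 1 := by
  have h : ((1 : ℕ) : ℂ) * s2D D ∈ Rpf D 1 := Subring.subset_closure rfl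
  simpa using h

lemma conj_eq_of_mem_Rp1 {D : ℕ} {x : ℂ} (hx : x ∈ Rpf D 1) : (starRingEnd ℂ) x = x := by
  induction hx using Subring.closure_induction with
  | mem y hy => rcases hy with rfl; simp [conj_s2D]
  | one => simp
  | zero => simp
  | add x y hx hy ihx ihy => rw [map_add, ihx, ihy]
  | neg x hx ihx => rw [map_neg, ihx]
  | mul x y hx hy ihx ihy => rw [map_mul, ihx, ihy]

lemma w_sq {D n : ℕ} (hn : D + 1 = 2 * n) : w D ^ 2 = s2D D * w D - n := by
  have hn' : (D : ℂ) + 1 = 2 * n := by exact_mod_cast hn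
  unfold w
  linear_combination (-1 / 4) * s2D_sq D + (1 / 4) * sm2_sq - (1 / 2) * hn'

/-- For odd `D`, the ring `R₁` is `R⁺₁ + R⁺₁·w`. -/
lemma exists_eq_add_mul_w {D : ℕ} (hD : Odd D) {x : ℂ} (hx : x ∈ Rf D 1) :
    ∃ p ∈ Rpf D 1, ∃ q ∈ Rpf D 1, x = p + q * w D := by
  obtain ⟨m, hm⟩ := hD
  have hw := w_sq (D := D) (n := m + 1) (by omega)
  induction hx using Subring.closure_induction with
  | mem y hy =>
      rcases hy with rfl | rfl
      · exact ⟨-s2D D, neg_mem (s2D_mem_Rp1 D), 2, ofNat_mem _ 2, by rw [s2D_eq]; ring⟩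
      · exact ⟨0, zero_mem _, 1, one_mem _, by simp⟩
  | one => exact ⟨1, one_mem _, 0, zero_mem _, by simp⟩
  | zero => exact ⟨0, zero_mem _, 0, zero_mem _, by simp⟩
  | add x y hx hy ihx ihy =>
      obtain ⟨p, hp, q, hq, rfl⟩ := ihx
      obtain ⟨p', hp', q', hq', rfl⟩ := ihy
      exact ⟨p + p', add_mem hp hp', q + q', add_mem hq hq', by ring⟩
  | neg x hx ihx =>
      obtain ⟨p, hp, q, hq, rfl⟩ := ihx
      exact ⟨-p, neg_mem hp, -q, neg_mem hq, by ring⟩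
  | mul x y hx hy ihx ihy =>
      obtain ⟨p, hp, q, hq, rfl⟩ := ihx
      obtain ⟨p', hp', q', hq', rfl⟩ := ihy
      refine ⟨p * p' - (m + 1 : ℕ) * (q * q'),
        sub_mem (mul_mem hp hp') (mul_mem (natCast_mem _ _) (mul_mem hq hq')),
        p * q' + q * p' + s2D D * (q * q'),
        add_mem (add_mem (mul_mem hp hq') (mul_mem hq hp'))
          (mul_mem (s2D_mem_Rp1 D) (mul_mem hq hq')), ?_⟩
      linear_combination q * q' * hw

/-- The trace of `K/K⁺` maps `R₁` into `R⁺₁`. -/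
lemma add_conj_mem_Rp1 {D : ℕ} (hD : Odd D) {x : ℂ} (hx : x ∈ Rf D 1) :
    x + (starRingEnd ℂ) x ∈ Rpf D 1 := by
  obtain ⟨p, hp, q, hq, rfl⟩ := exists_eq_add_mul_w hD hx
  have h : p + q * w D + (starRingEnd ℂ) (p + q * w D) = p + p + q * s2D D := by
    rw [map_add, map_mul, conj_eq_of_mem_Rp1 hp, conj_eq_of_mem_Rp1 hq, conj_w, s2D_eq]
    ring
  rw [h]
  exact add_mem (add_mem hp hp) (mul_mem hq (s2D_mem_Rp1 D))

lemma quotIncl_mk {R S : Subring ℂ} (h : R ≤ S) (f : ℕ) (x : R) :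
    quotIncl h f (Ideal.Quotient.mk _ x) = Ideal.Quotient.mk _ (Subring.inclusion h x) :=
  rfl

lemma quotConj_mk (R : Subring ℂ) (hc : ∀ x ∈ R, (starRingEnd ℂ) x ∈ R) (f : ℕ) (x : R) :
    quotConj R hc f (Ideal.Quotient.mk _ x) = Ideal.Quotient.mk _ (subringConj R hc x) :=
  rfl

/-- The natural map `R⁺₁/fR⁺₁ → R₁/fR₁` is injective for odd `D` and `f`. -/
lemma quotIncl_injective {D f : ℕ} (hD : Odd D) (hf : Odd f) :
    Function.Injective (quotIncl (Rpf_le_Rf D 1) f) := by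
  rw [injective_iff_map_eq_zero]
  intro a ha
  obtain ⟨z, rfl⟩ := Ideal.Quotient.mk_surjective a
  rw [quotIncl_mk, Ideal.Quotient.eq_zero_iff_mem, fIdeal, Ideal.mem_span_singleton] at ha
  obtain ⟨r, hr⟩ := ha
  have hzr : (z : ℂ) = f * r := by simpa using congrArg Subtype.val hr
  have hf0 : (f : ℂ) ≠ 0 := Nat.cast_ne_zero.2 hf.pos.ne'
  have hconj : (starRingEnd ℂ) (r : ℂ) = r := by
    have h := conj_eq_of_mem_Rp1 z.2
    rw [hzr, map_mul, map_natCast] at h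
    exact mul_left_cancel₀ hf0 h
  obtain ⟨k, hk⟩ := hf
  have hk' : (f : ℂ) = 2 * k + 1 := by exact_mod_cast hk
  have hmem : (r : ℂ) ∈ Rpf D 1 := by
    have h : (r : ℂ) = z - k * (r + (starRingEnd ℂ) (r : ℂ)) := by
      rw [hconj, hzr, hk']; ring
    rw [h]
    exact sub_mem z.2 (mul_mem (natCast_mem _ k) (add_conj_mem_Rp1 hD r.2))
  rw [Ideal.Quotient.eq_zero_iff_mem, fIdeal, Ideal.mem_span_singleton]
  exact ⟨⟨r, hmem⟩, Subtype.ext (by simpa using hzr)⟩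

/-- Elements of `R₁/fR₁` fixed by conjugation come from `R⁺₁/fR⁺₁` for odd `D` and `f`. -/
lemma exists_quotIncl_eq {D f : ℕ} (hD : Odd D) (hf : Odd f) (a : Rf D 1 ⧸ fIdeal (Rf D 1) f)
    (ha : quotConj (Rf D 1) (conj_mem_Rf D 1) f a = a) :
    ∃ b, quotIncl (Rpf_le_Rf D 1) f b = a := by
  obtain ⟨x, rfl⟩ := Ideal.Quotient.mk_surjective a
  rw [quotConj_mk, Ideal.Quotient.eq, fIdeal, Ideal.mem_span_singleton] at ha
  obtain ⟨r, hr⟩ := ha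
  have hxr : (starRingEnd ℂ) (x : ℂ) - x = f * r := by
    simpa [subringConj] using congrArg Subtype.val hr
  obtain ⟨k, hk⟩ := hf
  have hk' : (f : ℂ) = 2 * k + 1 := by exact_mod_cast hk
  refine ⟨Ideal.Quotient.mk _ ⟨(k + 1 : ℕ) * (x + (starRingEnd ℂ) (x : ℂ)),
    mul_mem (natCast_mem _ _) (add_conj_mem_Rp1 hD x.2)⟩, ?_⟩
  rw [quotIncl_mk, Ideal.Quotient.eq, fIdeal, Ideal.mem_span_singleton]
  refine ⟨x + (k + 1 : ℕ) * r, Subtype.ext ?_⟩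
  push_cast [Subring.coe_inclusion]
  linear_combination (k + 1 : ℂ) * hxr - x * hk'

/-- Let `f` be an odd positive integer.  Every unit of `R₁/fR₁` fixed by the
automorphism induced by complex conjugation lies in the image of `(R⁺₁/fR⁺₁)ˣ`
under the natural (injective) ring map `R⁺₁/fR⁺₁ → R₁/fR₁`. -/
theorem conj_fixed_units_come_from_real_subring (D : ℕ) (hD0 : 0 < D)
    (hDsf : Squarefree D) (hD4 : D % 4 = 1) (f : ℕ) (hf1 : Odd f) (hf0 : 0 < f)
    (u : ((Rf D 1) ⧸ fIdeal (Rf D 1) f)ˣ)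
    (hu : Units.map (quotConj (Rf D 1) (conj_mem_Rf D 1) f).toMonoidHom u = u) :
    ∃ v : ((Rpf D 1) ⧸ fIdeal (Rpf D 1) f)ˣ,
      Units.map (quotIncl (Rpf_le_Rf D 1) f).toMonoidHom v = u := by
  have hD : Odd D := Nat.odd_iff.2 (by omega)
  have hu' : Units.map (quotConj (Rf D 1) (conj_mem_Rf D 1) f).toMonoidHom u⁻¹ = u⁻¹ := by
    rw [map_inv, hu]
  obtain ⟨a, ha⟩ := exists_quotIncl_eq hD hf1 u (congrArg Units.val hu)
  obtain ⟨b, hb⟩ := exists_quotIncl_eq hD hf1 ↑u⁻¹ (congrArg Units.val hu')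
  have hab : a * b = 1 := quotIncl_injective hD hf1 (by
    rw [map_mul, ha, hb, map_one, Units.mul_inv])
  exact ⟨⟨a, b, hab, mul_comm b a ▸ hab⟩, Units.ext ha⟩
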